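/- Let F be a finite family of finite simple graphs such that some member of F contains no path on three vertices as a subgraph, and let F' = { F − isolated(F) : F ∈ F } be the family obtained by deleting the isolated vertices from each member. If a finite simple graph G contains no member of F as a minor but contains some member of F' as a minor, then |V(G)| < max_{F ∈ F} ( |V(F)| + 2·|V(F)|³ ). -/

import Mathlib

/-- An `H`-model in `G`: branch sets `φ v ⊆ V(G)` inducing connected subgraphs,
pairwise disjoint, with an edge of `G` between the branch sets of adjacent vertices of `H`. -/
def IsMinorModel {V W : Type*} (G : SimpleGraph V) (H : SimpleGraph W)
    (φ : W → Set V) : Prop :=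
  (∀ v : W, (G.induce (φ v)).Connected) ∧
  (∀ u v : W, H.Adj u v → ∃ u' ∈ φ u, ∃ v' ∈ φ v, G.Adj u' v') ∧
  (∀ u v : W, u ≠ v → Disjoint (φ u) (φ v))

/-- `H` is a minor of `G` (`H ⪯ G`) if an `H`-model in `G` exists. -/
def IsMinorOf {V W : Type*} (H : SimpleGraph W) (G : SimpleGraph V) : Prop :=
  ∃ φ : W → Set V, IsMinorModel G H φ

/-- `G` contains `H` as a subgraph: an injective map from `V(H)` to `V(G)`
mapping edges of `H` to edges of `G`. -/
def ContainsAsSubgraph {V W : Type*} (G : SimpleGraph V) (H : SimpleGraph W) : Prop :=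
  ∃ f : W → V, Function.Injective f ∧ ∀ u v : W, H.Adj u v → G.Adj (f u) (f v)

open scoped Classical in
/-- A graph of maximum degree at most one embeds into a path on as many vertices,
here the path `0, 1, …, |S| - 1`, for every vertex set `S` closed under adjacency. -/
lemma exists_path_placement {W : Type*} (H : SimpleGraph W)
    (hH : ∀ v a b, H.Adj v a → H.Adj v b → a = b) (S : Finset W)
    (hS : ∀ u ∈ S, ∀ v, H.Adj u v → v ∈ S) :
    ∃ f : W → ℕ, Set.InjOn f S ∧ (∀ u ∈ S, f u < S.card) ∧
      ∀ u ∈ S, ∀ v ∈ S, H.Adj u v → f u + 1 = f v ∨ f v + 1 = f u := by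
  induction S using Finset.strongInduction with
  | H S ih =>
  rcases S.eq_empty_or_nonempty with rfl | ⟨a, ha⟩
  · exact ⟨fun _ => 0, by simp⟩
  by_cases hiso : ∃ b, H.Adj a b
  · obtain ⟨b, hab⟩ := hiso
    have hb := hS a ha b hab
    have hne : a ≠ b := hab.ne
    have hcard : ((S.erase a).erase b).card + 2 = S.card := by
      have h₁ := Finset.card_erase_add_one ha
      have h₂ := Finset.card_erase_add_one (Finset.mem_erase.2 ⟨hne.symm, hb⟩)
      omega
    obtain ⟨f, hinj, hlt, hadj⟩ := ih ((S.erase a).erase b)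
      ((Finset.erase_subset _ _).trans_ssubset (Finset.erase_ssubset ha)) (by
        intro u hu v huv
        simp only [Finset.mem_erase] at hu ⊢
        refine ⟨?_, ?_, hS u hu.2.2 v huv⟩
        · rintro rfl
          exact hu.2.1 (hH _ _ _ huv.symm hab.symm)
        · rintro rfl
          exact hu.1 (hH _ _ _ huv.symm hab))
    set m := ((S.erase a).erase b).card
    have mem : ∀ u ∈ S, u ≠ a → u ≠ b → u ∈ (S.erase a).erase b := fun u hu h₁ h₂ => by
      simp [hu, h₁, h₂]
    refine ⟨fun u => if u = a then m else if u = b then m + 1 else f u, ?_, ?_, ?_⟩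
    · intro u hu v hv huv
      have hlu := fun h₁ h₂ => hlt u (mem u hu h₁ h₂)
      have hlv := fun h₁ h₂ => hlt v (mem v hv h₁ h₂)
      have hi := fun h₁ h₂ h₃ h₄ => hinj (mem u hu h₁ h₂) (mem v hv h₃ h₄)
      grind
    · intro u hu
      have hlu := fun h₁ h₂ => hlt u (mem u hu h₁ h₂)
      grind
    · intro u hu v hv huv
      have hi := fun h₁ h₂ h₃ h₄ => hadj u (mem u hu h₁ h₂) v (mem v hv h₃ h₄) huv
      have e₁ : u = a → v = b := by rintro rfl; exact hH _ _ _ huv hab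
      have e₂ : u = b → v = a := by rintro rfl; exact hH _ _ _ huv hab.symm
      have e₃ : v = a → u = b := by rintro rfl; exact hH _ _ _ huv.symm hab
      have e₄ : v = b → u = a := by rintro rfl; exact hH _ _ _ huv.symm hab.symm
      grind
  · push Not at hiso
    have hcard := Finset.card_erase_add_one ha
    obtain ⟨f, hinj, hlt, hadj⟩ := ih (S.erase a) (Finset.erase_ssubset ha) (by
        intro u hu v huv
        simp only [Finset.mem_erase] at hu ⊢
        refine ⟨?_, hS u hu.2 v huv⟩
        rintro rfl
        exact hiso _ huv.symm)
    set m := (S.erase a).card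
    have mem : ∀ u ∈ S, u ≠ a → u ∈ S.erase a := fun u hu h₁ => by simp [hu, h₁]
    refine ⟨fun u => if u = a then m else f u, ?_, ?_, ?_⟩
    · intro u hu v hv huv
      have hlu := fun h₁ => hlt u (mem u hu h₁)
      have hlv := fun h₁ => hlt v (mem v hv h₁)
      have hi := fun h₁ h₂ => hinj (mem u hu h₁) (mem v hv h₂)
      grind
    · intro u hu
      have hlu := fun h₁ => hlt u (mem u hu h₁)
      grind
    · intro u hu v hv huv
      have hi := fun h₁ h₂ => hadj u (mem u hu h₁) v (mem v hv h₂) huv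
      have e₁ : u ≠ a := by rintro rfl; exact hiso _ huv
      have e₂ : v ≠ a := by rintro rfl; exact hiso _ huv.symm
      grind

lemma eq_of_adj_of_not_containsAsSubgraph_pathGraph_three {W : Type*} {H : SimpleGraph W}
    (hH : ¬ ContainsAsSubgraph H (SimpleGraph.pathGraph 3)) {v a b : W}
    (ha : H.Adj v a) (hb : H.Adj v b) : a = b := by
  by_contra hab
  refine hH ⟨![a, v, b], ?_, ?_⟩
  · intro i j hij
    have h₁ := ha.ne
    have h₂ := hb.ne
    fin_cases i <;> fin_cases j <;> simp_all
  · intro i j hij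
    rw [SimpleGraph.pathGraph_adj] at hij
    have h₁ := ha.symm
    have h₂ := hb.symm
    fin_cases i <;> fin_cases j <;> simp_all

lemma ContainsAsSubgraph.isMinorOf {V W : Type*} {G : SimpleGraph V} {H : SimpleGraph W}
    (h : ContainsAsSubgraph G H) : IsMinorOf H G := by
  obtain ⟨f, hinj, hadj⟩ := h
  refine ⟨fun w => {f w}, fun v => ?_, fun u v huv => ⟨_, rfl, _, rfl, hadj u v huv⟩,
    fun u v huv => by simpa using hinj.ne huv⟩
  have : Nonempty ({f v} : Set V) := ⟨⟨f v, rfl⟩⟩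
  exact ⟨SimpleGraph.Preconnected.of_subsingleton⟩

/-- If `H` contains no path on three vertices and is not a minor of `G`,
then every path of `G` has fewer than `|V(H)|` vertices. -/
lemma length_succ_lt_card_of_isPath {V W : Type*} [Fintype W] {G : SimpleGraph V}
    {H : SimpleGraph W} (hH : ¬ ContainsAsSubgraph H (SimpleGraph.pathGraph 3))
    (hfree : ¬ IsMinorOf H G) {a b : V} {p : G.Walk a b} (hp : p.IsPath) :
    p.length + 1 < Fintype.card W := by
  by_contra! hlen
  obtain ⟨f, hinj, hlt, hadj⟩ := exists_path_placement H
    (fun _ _ _ => eq_of_adj_of_not_containsAsSubgraph_pathGraph_three hH) Finset.univ (by simp)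
  simp only [Finset.mem_univ, forall_const, Finset.card_univ] at hlt hadj
  have hle : ∀ u, f u ≤ p.length := fun u => by have := hlt u; omega
  refine hfree (ContainsAsSubgraph.isMinorOf ⟨fun u => p.getVert (f u), ?_, ?_⟩)
  · intro u v huv
    exact hinj (by simp) (by simp) (hp.getVert_injOn (hle u) (hle v) huv)
  · intro u v huv
    have hu := hle u
    have hv := hle v
    rcases hadj u v huv with h | h
    · have := p.adj_getVert_succ (i := f u) (by omega)
      rwa [h] at this
    · have := p.adj_getVert_succ (i := f v) (by omega)
      rw [h] at this
      exact this.symm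

open scoped Classical in
/-- In a graph whose paths have at most `n` vertices, a set `T` of vertices of a connected set `S`
spans a connected subset of `S` with at most `|T| * n` vertices. -/
lemma exists_connected_card_le {V : Type*} {G : SimpleGraph V} {n : ℕ}
    (hn : ∀ (a b : V) (p : G.Walk a b), p.IsPath → p.length + 1 ≤ n)
    {S : Set V} (hS : (G.induce S).Connected) (T : Finset V) (hT : T.Nonempty)
    (hTS : ∀ t ∈ T, t ∈ S) :
    ∃ U : Finset V, T ⊆ U ∧ (∀ u ∈ U, u ∈ S) ∧ (G.induce (U : Set V)).Connected ∧
      U.card ≤ T.card * n := by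
  obtain ⟨r, hr⟩ := hT
  have key : ∀ t, ∃ U : Finset V, t ∈ T → r ∈ U ∧ t ∈ U ∧ (∀ u ∈ U, u ∈ S) ∧
      (G.induce (U : Set V)).Connected ∧ U.card ≤ n := by
    intro t
    by_cases ht : t ∈ T
    · obtain ⟨q⟩ := hS.preconnected ⟨r, hTS r hr⟩ ⟨t, hTS t ht⟩
      let p : G.Walk r t := (q.map (SimpleGraph.Embedding.induce S).toHom).bypass
      have hp : p.IsPath := SimpleGraph.Walk.bypass_isPath _
      refine ⟨p.support.toFinset, fun _ => ⟨by simp, by simp, ?_, ?_, ?_⟩⟩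
      · intro u hu
        have hu' : u ∈ q.support.map (SimpleGraph.Embedding.induce (G := G) S).toHom := by
          rw [← SimpleGraph.Walk.support_map]
          exact SimpleGraph.Walk.support_bypass_subset_support _ (List.mem_toFinset.1 hu)
        obtain ⟨x, -, rfl⟩ := List.mem_map.1 hu'
        exact x.2
      · rw [List.coe_toFinset]
        exact p.connected_induce_support
      · refine (List.toFinset_card_le _).trans ?_
        rw [SimpleGraph.Walk.length_support]
        exact hn _ _ p hp
    · exact ⟨∅, fun h => absurd h ht⟩
  choose U hU using key
  refine ⟨T.biUnion U, fun t ht => Finset.mem_biUnion.2 ⟨t, ht, (hU t ht).2.1⟩, ?_, ?_,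
    Finset.card_biUnion_le_card_mul _ _ _ fun t ht => (hU t ht).2.2.2.2⟩
  · intro u hu
    obtain ⟨t, ht, hut⟩ := Finset.mem_biUnion.1 hu
    exact (hU t ht).2.2.1 u hut
  · refine SimpleGraph.induce_connected_of_patches r
      (Finset.mem_coe.2 (Finset.mem_biUnion.2 ⟨r, hr, (hU r hr).1⟩)) fun {v} hv => ?_
    obtain ⟨t, ht, hvt⟩ := Finset.mem_biUnion.1 (Finset.mem_coe.1 hv)
    exact ⟨U t, Finset.coe_subset.2 (Finset.subset_biUnion_of_mem U ht), (hU t ht).1, hvt,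
      (hU t ht).2.2.2.1.preconnected _ _⟩

open scoped Classical in
/-- If all paths of `G` have at most `n` vertices, then every minor without isolated vertices
of `G` has a model with at most `2 * |V(H)|² * n` vertices. -/
lemma IsMinorOf.exists_model_card_le {V W : Type*} [Fintype W] {G : SimpleGraph V}
    {H : SimpleGraph W} {n : ℕ}
    (hn : ∀ (a b : V) (p : G.Walk a b), p.IsPath → p.length + 1 ≤ n)
    (hiso : ∀ v, ∃ u, H.Adj v u) (h : IsMinorOf H G) :
    ∃ U : W → Finset V, IsMinorModel G H (fun v => (U v : Set V)) ∧
      (Finset.univ.biUnion U).card ≤ Fintype.card W * (2 * Fintype.card W * n) := by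
  obtain ⟨φ, hconn, hadj, hdisj⟩ := h
  have hne : ∀ u v, ∃ x y, H.Adj u v → x ∈ φ u ∧ y ∈ φ v ∧ G.Adj x y := by
    intro u v
    by_cases huv : H.Adj u v
    · obtain ⟨x, hx, y, hy, hxy⟩ := hadj u v huv
      exact ⟨x, y, fun _ => ⟨hx, hy, hxy⟩⟩
    · obtain ⟨x⟩ := (hconn u).nonempty
      exact ⟨x, x, fun h => absurd h huv⟩
  choose x y hxy using hne
  let N : W → Finset W := fun u => Finset.univ.filter (H.Adj u)
  let T : W → Finset V := fun u => (N u).image (x u) ∪ (N u).image (fun v => y v u)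
  have hTcard : ∀ u, (T u).card ≤ 2 * Fintype.card W := fun u => by
    have h₁ : ((N u).image (x u)).card ≤ Fintype.card W :=
      Finset.card_image_le.trans (Finset.card_le_univ _)
    have h₂ : ((N u).image (fun v => y v u)).card ≤ Fintype.card W :=
      Finset.card_image_le.trans (Finset.card_le_univ _)
    have h₃ := Finset.card_union_le ((N u).image (x u)) ((N u).image (fun v => y v u))
    change (_ ∪ _ : Finset V).card ≤ _
    omega
  have hTx : ∀ u v, H.Adj u v → x u v ∈ T u := fun u v huv =>
    Finset.mem_union_left _ (Finset.mem_image_of_mem _ (by simpa [N] using huv))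
  have hTy : ∀ u v, H.Adj u v → y u v ∈ T v := fun u v huv =>
    Finset.mem_union_right _ (Finset.mem_image.2 ⟨u, by simpa [N] using huv.symm, rfl⟩)
  have hTφ : ∀ u, ∀ t ∈ T u, t ∈ φ u := by
    intro u t ht
    rcases Finset.mem_union.1 ht with ht | ht <;>
    obtain ⟨v, hv, rfl⟩ := Finset.mem_image.1 ht
    · exact (hxy u v (by simpa [N] using hv)).1
    · exact (hxy v u (SimpleGraph.Adj.symm (by simpa [N] using hv))).2.1
  have key := fun u => exists_connected_card_le hn (hconn u) (T u)
    (let ⟨v, hv⟩ := hiso u; ⟨x u v, hTx u v hv⟩) (hTφ u)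
  choose U hTU hUφ hUconn hUcard using key
  refine ⟨U, ⟨hUconn, fun u v huv => ⟨x u v, hTU u (hTx u v huv), y u v, hTU v (hTy u v huv),
    (hxy u v huv).2.2⟩, fun u v huv => ?_⟩, ?_⟩
  · exact (hdisj u v huv).mono (fun a ha => hUφ u a ha) (fun a ha => hUφ v a ha)
  · exact Finset.card_biUnion_le_card_mul _ _ _ fun u _ =>
      (hUcard u).trans (Nat.mul_le_mul_right _ (hTcard u))

open scoped Classical in
/-- A model of `H` minus its isolated vertices extends to a model of `H` if there is enough room
outside of it. -/
lemma isMinorOf_of_model_induce {V W : Type*} [Fintype V] [Fintype W] {G : SimpleGraph V}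
    {H : SimpleGraph W} (U : {v | ∃ u, H.Adj v u} → Finset V)
    (hU : IsMinorModel G (H.induce {v | ∃ u, H.Adj v u}) (fun v => (U v : Set V)))
    (hcard : Fintype.card W + (Finset.univ.biUnion U).card ≤ Fintype.card V) :
    IsMinorOf H G := by
  obtain ⟨hconn, hadj, hdisj⟩ := hU
  obtain ⟨g⟩ : Nonempty (W ↪ ((Finset.univ.biUnion U)ᶜ : Finset V)) := by
    apply Function.Embedding.nonempty_of_card_le
    rw [Fintype.card_coe, Finset.card_compl]
    omega
  have hg : ∀ w v, (g w : V) ∉ U v := fun w v hv =>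
    Finset.mem_compl.1 (g w).2 (Finset.mem_biUnion.2 ⟨v, Finset.mem_univ _, hv⟩)
  refine ⟨fun w => if hw : ∃ u, H.Adj w u then (U ⟨w, hw⟩ : Set V) else {(g w : V)},
    ?_, ?_, ?_⟩
  · intro v
    by_cases hv : ∃ u, H.Adj v u
    · beta_reduce
      rw [dif_pos hv]
      exact hconn ⟨v, hv⟩
    · beta_reduce
      rw [dif_neg hv]
      have : Nonempty ({(g v : V)} : Set V) := ⟨⟨_, rfl⟩⟩
      exact ⟨SimpleGraph.Preconnected.of_subsingleton⟩
  · intro u v huv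
    have hu : ∃ w, H.Adj u w := ⟨v, huv⟩
    have hv : ∃ w, H.Adj v w := ⟨u, huv.symm⟩
    simp only [dif_pos hu, dif_pos hv]
    exact hadj ⟨u, hu⟩ ⟨v, hv⟩ huv
  · intro u v huv
    by_cases hu : ∃ w, H.Adj u w <;> by_cases hv : ∃ w, H.Adj v w
    · simp only [dif_pos hu, dif_pos hv]
      exact hdisj ⟨u, hu⟩ ⟨v, hv⟩ (by simpa using huv)
    · simp only [dif_pos hu, dif_neg hv]
      exact Set.disjoint_singleton_right.2 (hg v _)
    · simp only [dif_neg hu, dif_pos hv]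
      exact Set.disjoint_singleton_left.2 (hg u _)
    · simp only [dif_neg hu, dif_neg hv]
      rw [Set.disjoint_singleton]
      exact fun h => huv (g.injective (Subtype.ext h))

/-- Let `F` be a finite family of finite simple graphs such that some member contains no
path on three vertices as a subgraph, and let `F' = { F − isolated(F) : F ∈ F }` (the
member `F i` with its isolated vertices deleted is the subgraph induced by the vertices
with a neighbor). If `G` contains no member of `F` as a minor but contains some member
of `F'` as a minor, then `|V(G)| < max_{F ∈ F} (|V(F)| + 2|V(F)|³)`. -/
theorem stmt_11 {ι : Type*} [Fintype ι] {W : ι → Type*} [∀ i, Fintype (W i)]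
    (F : ∀ i, SimpleGraph (W i))
    (hP3 : ∃ i, ¬ ContainsAsSubgraph (F i) (SimpleGraph.pathGraph 3))
    {V : Type*} [Fintype V] (G : SimpleGraph V)
    (hfree : ∀ i, ¬ IsMinorOf (F i) G)
    (hmem : ∃ i, IsMinorOf ((F i).induce {v | ∃ u, (F i).Adj v u}) G) :
    Fintype.card V <
      Finset.univ.sup (fun i => Fintype.card (W i) + 2 * (Fintype.card (W i)) ^ 3) := by
  classical
  by_contra! hle
  have hle' : ∀ i, Fintype.card (W i) + 2 * Fintype.card (W i) ^ 3 ≤ Fintype.card V := fun i =>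
    (Finset.le_sup (f := fun i => Fintype.card (W i) + 2 * Fintype.card (W i) ^ 3)
      (Finset.mem_univ i)).trans hle
  obtain ⟨i, hi⟩ := hP3
  obtain ⟨j, hj⟩ := hmem
  obtain ⟨U, hU, hUcard⟩ := hj.exists_model_card_le (n := Fintype.card (W i))
    (fun a b p hp => (length_succ_lt_card_of_isPath hi (hfree i) hp).le)
    (fun ⟨v, u, huv⟩ => ⟨⟨u, v, huv.symm⟩, huv⟩)
  refine hfree j (isMinorOf_of_model_induce U hU ?_)
  set w := Fintype.card (W i)
  set h := Fintype.card (W j)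
  have hle_h : Fintype.card {v | ∃ u, (F j).Adj v u} ≤ h := Fintype.card_subtype_le _
  obtain ⟨n, hwn, hhn, hn⟩ : ∃ n, w ≤ n ∧ h ≤ n ∧ n + 2 * n ^ 3 ≤ Fintype.card V := by
    rcases le_total w h with hwh | hwh
    · exact ⟨h, hwh, le_rfl, hle' j⟩
    · exact ⟨w, le_rfl, hwh, hle' i⟩
  calc h + (Finset.univ.biUnion U).card
      ≤ n + n * (2 * n * n) := by
        refine add_le_add hhn (hUcard.trans ?_)
        have := hle_h.trans hhn
        gcongr
    _ = n + 2 * n ^ 3 := by ring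
    _ ≤ Fintype.card V := hn
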